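/- For every integer n, V_n = ((α² − r·α)·V_0 + α·V_1 + t·V_{−1})·α^n/((α−γ)(α−β)) + ((β² − r·β)·V_0 + β·V_1 + t·V_{−1})·β^n/((β−γ)(β−α)) + ((γ² − r·γ)·V_0 + γ·V_1 + t·V_{−1})·γ^n/((γ−α)(γ−β)). -/

import Mathlib

theorem geom_aux (f : ℤ → ℂ) (a : ℂ) (ha : a ≠ 0) (h : ∀ n, f (n + 1) = a * f n) (n : ℤ) :
    f n = f 0 * a ^ n := by
  induction n using Int.induction_on with
  | zero => simp
  | succ k ih => rw [h, ih, zpow_add_one₀ ha]; ring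
  | pred k ih =>
    have h1 := h (-(k : ℤ) - 1)
    rw [sub_add_cancel, ih] at h1
    apply mul_left_cancel₀ ha
    rw [← h1, zpow_sub_one₀ ha]
    field_simp

theorem key_aux (r s t : ℂ) (V : ℤ → ℂ)
    (hV : ∀ n : ℤ, V n = r * V (n - 1) + s * V (n - 2) + t * V (n - 3))
    (a b c : ℂ) (ha : a ≠ 0) (h1 : a + b + c = r) (h2 : a * b + a * c + b * c = -s)
    (h3 : a * b * c = t) (n : ℤ) :
    ((a ^ 2 - r * a) * V 0 + a * V 1 + t * V (-1)) * a ^ n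
      = a * (V (n + 1) - (b + c) * V n + b * c * V (n - 1)) := by
  have hs : s = -(a * b + a * c + b * c) := by rw [h2]; ring
  have := geom_aux (fun n => V (n + 1) - (b + c) * V n + b * c * V (n - 1)) a ha (by
    intro m
    have e := hV (m + 1 + 1)
    rw [show m + 1 + 1 - 1 = m + 1 by ring, show m + 1 + 1 - 2 = m by ring,
      show m + 1 + 1 - 3 = m - 1 by ring] at e
    simp only [show m + 1 - 1 = m by ring]
    rw [e, hs, ← h1, ← h3]
    ring) n
  simp only [zero_add, zero_sub] at this
  rw [this, ← h1, ← h3]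
  ring

theorem generalized_tribonacci_binet_second_form
    (r s t : ℂ) (ht : t ≠ 0) (V : ℤ → ℂ)
    (hV : ∀ n : ℤ, V n = r * V (n - 1) + s * V (n - 2) + t * V (n - 3))
    (α β γ : ℂ)
    (hα : α ^ 3 - r * α ^ 2 - s * α - t = 0)
    (hβ : β ^ 3 - r * β ^ 2 - s * β - t = 0)
    (hγ : γ ^ 3 - r * γ ^ 2 - s * γ - t = 0)
    (hαβ : α ≠ β) (hαγ : α ≠ γ) (hβγ : β ≠ γ)
    (hsum : α + β + γ = r)
    (hsum2 : α * β + α * γ + β * γ = -s)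
    (hprod : α * β * γ = t) :
    ∀ n : ℤ, V n =
      ((α ^ 2 - r * α) * V 0 + α * V 1 + t * V (-1)) * α ^ n / ((α - γ) * (α - β))
      + ((β ^ 2 - r * β) * V 0 + β * V 1 + t * V (-1)) * β ^ n / ((β - γ) * (β - α))
      + ((γ ^ 2 - r * γ) * V 0 + γ * V 1 + t * V (-1)) * γ ^ n / ((γ - α) * (γ - β)) := by
  intro n
  have hα0 : α ≠ 0 := by rintro rfl; apply ht; rw [← hprod]; ring
  have hβ0 : β ≠ 0 := by rintro rfl; apply ht; rw [← hprod]; ring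
  have hγ0 : γ ≠ 0 := by rintro rfl; apply ht; rw [← hprod]; ring
  rw [key_aux r s t V hV α β γ hα0 hsum hsum2 hprod n,
    key_aux r s t V hV β γ α hβ0 (by rw [← hsum]; ring) (by rw [← hsum2]; ring)
      (by rw [← hprod]; ring) n,
    key_aux r s t V hV γ α β hγ0 (by rw [← hsum]; ring) (by rw [← hsum2]; ring)
      (by rw [← hprod]; ring) n]
  have d1 := sub_ne_zero.2 hαβ
  have d2 := sub_ne_zero.2 hαγ
  have d3 := sub_ne_zero.2 hβγ
  rw [← neg_sub α β, ← neg_sub α γ, ← neg_sub β γ]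
  field_simp
  ring
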